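/- Let $R$ be a ring and $n$ a natural number. Then every right $R$-module has projective dimension at most $n$ (i.e., the right global dimension of $R$ is at most $n$) if and only if every composite of $n+1$ ghost morphisms in the derived category $D(R)$ of right $R$-modules is zero. -/

import Mathlib

open CategoryTheory

universe w

/-- A morphism in the derived category is a *ghost* if it induces the zero map on all
homology objects. -/
def IsGhost {C : Type*} [Category C] [Abelian C] [HasDerivedCategory.{w} C]
    {X Y : DerivedCategory C} (f : X ⟶ Y) : Prop :=
  ∀ n : ℤ, (DerivedCategory.homologyFunctor C n).map f = 0

/-- `IsGhostComposite f k` means that the morphism `f` in the derived category can be written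
as a composite of `k` ghost morphisms. -/
inductive IsGhostComposite {C : Type*} [Category C] [Abelian C] [HasDerivedCategory.{w} C] :
    ∀ {X Y : DerivedCategory C}, (X ⟶ Y) → ℕ → Prop
  | single {X Y : DerivedCategory C} {f : X ⟶ Y} (h : IsGhost f) : IsGhostComposite f 1
  | comp {X Y Z : DerivedCategory C} {f : X ⟶ Y} {g : Y ⟶ Z} {k : ℕ}
      (hf : IsGhostComposite f k) (hg : IsGhost g) : IsGhostComposite (f ≫ g) (k + 1)

/-- An object of an abelian category has projective dimension at most `n` if it admits a
projective resolution of length at most `n`, i.e. a projective resolution whose terms vanish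
in degrees greater than `n`. -/
def HasProjDimLE {C : Type*} [Category C] [Abelian C] (X : C) (n : ℕ) : Prop :=
  ∃ P : ProjectiveResolution X, ∀ i : ℕ, n < i → Limits.IsZero (P.complex.X i)

open Limits ZeroObject Abelian DerivedCategory Pretriangulated

section ZeroDifferential

variable {C : Type*} [Category C] [Abelian C] {K L : CochainComplex C ℤ}

/-- The homology of a complex with zero differentials is given by its terms. -/
noncomputable def homologyIsoOfDEqZero (hL : ∀ i j, L.d i j = 0) (i : ℤ) : L.homology i ≅ L.X i :=
  (L.isoHomologyπ (i - 1) i (by simp) (hL _ _)).symm ≪≫ L.iCyclesIso i (i + 1) (by simp) (hL _ _)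

/-- A morphism from a complex of projectives with zero differentials
which induces zero on homology is null-homotopic. -/
lemma nonempty_homotopy_zero_of_homologyMap_eq_zero (hL : ∀ i j, L.d i j = 0)
    [∀ i, Projective (L.X i)] (f : L ⟶ K)
    (hf : ∀ i, HomologicalComplex.homologyMap f i = 0) : Nonempty (Homotopy f 0) := by
  have key : ∀ i j : ℤ, j + 1 = i → ∃ h : L.X i ⟶ K.X j, h ≫ K.d j i = f.f i := by
    intro i j hij
    have hS : (ShortComplex.mk _ _ (K.toCycles_comp_homologyπ j i)).Exact :=
      ShortComplex.exact_of_g_is_cokernel _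
        (K.homologyIsCokernel j i ((ComplexShape.up ℤ).prev_eq' hij))
    have := L.isIso_iCycles i (i + 1) (by simp) (hL _ _)
    have hc : (inv (L.iCycles i) ≫ HomologicalComplex.cyclesMap f i) ≫ K.homologyπ i = 0 := by
      rw [Category.assoc, ← HomologicalComplex.homologyπ_naturality, hf]
      simp
    refine ⟨hS.liftFromProjective _ hc, ?_⟩
    have := hS.liftFromProjective_comp _ hc
    dsimp at this
    rw [← K.toCycles_i j i, reassoc_of% this]
    simp
  choose h hh using key
  refine ⟨{ hom := fun i j => if hij : j + 1 = i then h i j hij else 0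
            zero := fun i j hij => dif_neg hij
            comm := fun i => ?_ }⟩
  rw [dNext_eq _ (show (ComplexShape.up ℤ).Rel i (i + 1) by simp),
    prevD_eq _ (show (ComplexShape.up ℤ).Rel (i - 1) i by simp)]
  simp [hh, hL]

lemma isKProjective_of_d_eq_zero (hL : ∀ i j, L.d i j = 0) [∀ i, Projective (L.X i)] :
    L.IsKProjective where
  nonempty_homotopy_zero f hK := nonempty_homotopy_zero_of_homologyMap_eq_zero hL f
    (fun i ↦ (hK i).isZero_homology.eq_of_tgt _ _)

lemma exists_homologyMap_eq_of_d_eq_zero (hL : ∀ i j, L.d i j = 0) [∀ i, Projective (L.X i)]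
    (π : ∀ i, L.X i ⟶ K.homology i) :
    ∃ φ : L ⟶ K, ∀ i,
      HomologicalComplex.homologyMap φ i = (homologyIsoOfDEqZero hL i).hom ≫ π i := by
  let s (i : ℤ) : L.X i ⟶ K.cycles i := Projective.factorThru (π i) (K.homologyπ i)
  let φ : L ⟶ K :=
    { f := fun i ↦ s i ≫ K.iCycles i
      comm' := fun i j _ ↦ by simp [hL] }
  refine ⟨φ, fun i ↦ ?_⟩
  have h : HomologicalComplex.cyclesMap φ i = L.iCycles i ≫ s i := by
    rw [← cancel_mono (K.iCycles i), HomologicalComplex.cyclesMap_i, Category.assoc]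
  rw [← cancel_epi (L.homologyπ i), HomologicalComplex.homologyπ_naturality, h]
  simp [homologyIsoOfDEqZero, s]

/-- Any family of morphisms from projective objects to the homology of a complex `K` is induced by
a morphism to `K` from a complex of projectives with zero differentials. -/
lemma exists_hom_of_projective_to_homology (K : CochainComplex C ℤ) {P : ℤ → C}
    [hP : ∀ i, Projective (P i)] (π : ∀ i, P i ⟶ K.homology i) :
    ∃ (L : CochainComplex C ℤ) (_ : ∀ i j, L.d i j = 0) (_ : ∀ i, Projective (L.X i))
      (φ : L ⟶ K) (e : ∀ i, L.homology i ≅ P i),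
      ∀ i, HomologicalComplex.homologyMap φ i = (e i).hom ≫ π i := by
  let L : CochainComplex C ℤ := { X := P, d := fun _ _ ↦ 0 }
  have : ∀ i, Projective (L.X i) := hP
  obtain ⟨φ, hφ⟩ := exists_homologyMap_eq_of_d_eq_zero (L := L) (fun _ _ ↦ rfl) π
  exact ⟨L, fun _ _ ↦ rfl, hP, φ, homologyIsoOfDEqZero (L := L) fun _ _ ↦ rfl, hφ⟩

lemma exists_projective_epi_kernel [EnoughProjectives C] (M : C) (d : ℕ)
    [hM : HasProjectiveDimensionLT M (d + 1)] :
    ∃ (P : C) (_ : Projective P) (π : P ⟶ M) (_ : Epi π),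
      HasProjectiveDimensionLT (kernel π) d := by
  obtain _ | d := d
  · exact ⟨M, projective_iff_hasProjectiveDimensionLT_one.2 hM, 𝟙 M, inferInstance,
      (isZero_kernel_of_mono (𝟙 M)).hasProjectiveDimensionLT_zero⟩
  · let S := ShortComplex.mk _ _ (kernel.condition (Projective.π M))
    have hS : S.ShortExact :=
      { exact := ShortComplex.exact_of_f_is_kernel _ (kernelIsKernel S.g) }
    exact ⟨_, inferInstance, Projective.π M, inferInstance,
      (hS.hasProjectiveDimensionLT_X₃_iff d (Projective.projective_over M)).1 hM⟩

end ZeroDifferential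

section GhostLemma

variable {C : Type*} [Category C] [Abelian C] [HasDerivedCategory.{w} C]

lemma IsGhost.comp_left {X Y Z : DerivedCategory C} {g : Y ⟶ Z} (hg : IsGhost g) (f : X ⟶ Y) :
    IsGhost (f ≫ g) := fun n ↦ by
  rw [Functor.map_comp, hg n, comp_zero]

lemma IsGhost.comp_right {X Y Z : DerivedCategory C} {f : X ⟶ Y} (hf : IsGhost f) (g : Y ⟶ Z) :
    IsGhost (f ≫ g) := fun n ↦ by
  rw [Functor.map_comp, hf n, zero_comp]

variable (C) in
/-- The homology of the image of a cochain complex in the derived category. -/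
noncomputable def homologyQObjIso (K : CochainComplex C ℤ) (i : ℤ) :
    (homologyFunctor C i).obj (Q.obj K) ≅ K.homology i :=
  (homologyFunctorFactors C i).app K

lemma homologyFunctor_map_Q_map {K L : CochainComplex C ℤ} (f : K ⟶ L) (i : ℤ) :
    (homologyFunctor C i).map (Q.map f) = (homologyQObjIso C K i).hom ≫
      HomologicalComplex.homologyMap f i ≫ (homologyQObjIso C L i).inv := by
  rw [← Category.assoc, Iso.eq_comp_inv]
  exact homologyFunctorFactors_hom_naturality f i

/-- Ghosts out of a complex of projectives with zero differentials vanish. -/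
lemma IsGhost.eq_zero_of_d_eq_zero {L : CochainComplex C ℤ} (hL : ∀ i j, L.d i j = 0)
    [∀ i, Projective (L.X i)] {Y : DerivedCategory C} {f : Q.obj L ⟶ Y} (hf : IsGhost f) :
    f = 0 := by
  let e := Q.objObjPreimageIso Y
  rw [← cancel_mono e.inv, zero_comp]
  replace hf := hf.comp_right e.inv
  generalize f ≫ e.inv = f' at hf
  have := isKProjective_of_d_eq_zero hL
  obtain ⟨g, hg⟩ := (CochainComplex.IsKProjective.Qh_map_bijective _ _).surjective
    ((quotientCompQhIso C).hom.app _ ≫ f' ≫ (quotientCompQhIso C).inv.app _)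
  obtain ⟨g, rfl⟩ := (HomotopyCategory.quotient _ _).map_surjective g
  have hfg : f' = Q.map g := by
    rw [← cancel_epi ((quotientCompQhIso C).hom.app _),
      ← cancel_mono ((quotientCompQhIso C).inv.app _), Category.assoc, ← hg]
    rw [← (quotientCompQhIso C).hom.naturality g]
    simp
  subst hfg
  obtain ⟨h⟩ := nonempty_homotopy_zero_of_homologyMap_eq_zero hL g (fun i ↦ by
    simpa [homologyFunctor_map_Q_map] using hf i)
  rw [Q_map_eq_of_homotopy C h, Functor.map_zero]

/-- A ghost out of an object with homology of projective dimension `< d + 1` factors through an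
object with homology of projective dimension `< d`. -/
lemma IsGhost.exists_factor [EnoughProjectives C] {X Y : DerivedCategory C} {f : X ⟶ Y}
    (hf : IsGhost f) (d : ℕ)
    (hX : ∀ i, HasProjectiveDimensionLT ((homologyFunctor C i).obj X) (d + 1)) :
    ∃ (Z : DerivedCategory C) (p : X ⟶ Z) (h : Z ⟶ Y), f = p ≫ h ∧
      ∀ i, HasProjectiveDimensionLT ((homologyFunctor C i).obj Z) d := by
  let K := Q.objPreimage X
  let e : Q.obj K ≅ X := Q.objObjPreimageIso X
  have hK (i : ℤ) : HasProjectiveDimensionLT (K.homology i) (d + 1) :=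
    have := hX i
    hasProjectiveDimensionLT_of_iso
      ((homologyFunctor C i).mapIso e.symm ≪≫ homologyQObjIso C K i) _
  choose P hP π hπ hker using fun i ↦ exists_projective_epi_kernel (K.homology i) d
  obtain ⟨L, hL, _, φ, e', hφ⟩ := exists_hom_of_projective_to_homology K π
  have hφ' (i : ℤ) : (homologyFunctor C i).map (Q.map φ) =
      ((homologyQObjIso C L i).hom ≫ (e' i).hom) ≫ π i ≫ (homologyQObjIso C K i).inv := by
    simp [homologyFunctor_map_Q_map, hφ]
  obtain ⟨Z, p, δ, hT⟩ := distinguished_cocone_triangle (Q.map φ)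
  obtain ⟨h, hh⟩ : ∃ h : Z ⟶ Y, e.hom ≫ f = p ≫ h :=
    Triangle.yoneda_exact₂ _ hT (e.hom ≫ f)
      (((hf.comp_left e.hom).comp_left (Q.map φ)).eq_zero_of_d_eq_zero hL)
  refine ⟨Z, e.inv ≫ p, h, ?_, fun i ↦ ?_⟩
  · rw [Category.assoc, ← hh, e.inv_hom_id_assoc]
  have hepi (j : ℤ) : Epi ((homologyFunctor C j).map (Q.map φ)) := by
    rw [hφ']
    infer_instance
  have hmono : Mono (HomologySequence.δ _ i (i + 1) rfl) :=
    (HomologySequence.exact₃ _ hT i (i + 1) rfl).mono_g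
      ((HomologySequence.epi_homologyMap_mor₁_iff _ hT i).1 (hepi i))
  have iso := IsLimit.conePointUniqueUpToIso
    (HomologySequence.exact₁ _ hT i (i + 1) rfl).fIsKernel
    (kernelIsKernel ((homologyFunctor C (i + 1)).map (Q.map φ)))
  have iso' : kernel (π (i + 1)) ≅ kernel ((homologyFunctor C (i + 1)).map (Q.map φ)) :=
    (kernelCompMono _ _).symm ≪≫ (kernelIsIsoComp _ _).symm ≪≫ kernelIsoOfEq (hφ' (i + 1)).symm
  have := hker (i + 1)
  exact hasProjectiveDimensionLT_of_iso (iso' ≪≫ iso.symm) d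

lemma IsGhostComposite.exists_factor [EnoughProjectives C] {X Y : DerivedCategory C} {f : X ⟶ Y}
    {m : ℕ} (hf : IsGhostComposite f m) (d : ℕ)
    (hX : ∀ i, HasProjectiveDimensionLT ((homologyFunctor C i).obj X) (d + m)) :
    ∃ (Z : DerivedCategory C) (p : X ⟶ Z) (h : Z ⟶ Y), f = p ≫ h ∧
      ∀ i, HasProjectiveDimensionLT ((homologyFunctor C i).obj Z) d := by
  induction hf generalizing d with
  | single h => exact h.exists_factor d hX
  | comp _ hg ih =>
    obtain ⟨Z, p, h, rfl, hZ⟩ := ih (d + 1) (by simpa only [add_assoc, add_comm 1] using hX)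
    obtain ⟨Z', p', h', hfac, hZ'⟩ := (hg.comp_left h).exists_factor d hZ
    exact ⟨Z', p ≫ p', h', by rw [Category.assoc, hfac, Category.assoc], hZ'⟩

/-- If the homology of `X` has projective dimension `< n`, then any composite of `n` ghosts
out of `X` vanishes. -/
lemma IsGhostComposite.eq_zero [EnoughProjectives C] {X Y : DerivedCategory C} {f : X ⟶ Y}
    {n : ℕ} (hf : IsGhostComposite f n)
    (hX : ∀ i, HasProjectiveDimensionLT ((homologyFunctor C i).obj X) n) : f = 0 := by
  obtain ⟨Z, p, h, rfl, hZ⟩ := hf.exists_factor 0 (by simpa using hX)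
  have hZ (i : ℤ) : IsZero ((homologyFunctor C i).obj Z) :=
    have := hZ i
    isZero_of_hasProjectiveDimensionLT_zero _
  have hp : IsIso (0 : Z ⟶ 0) := (isIso_iff _ _).2 fun i ↦ by
    refine (hZ i).isIso ?_ _
    exact (homologyFunctor C i).map_isZero (isZero_zero _)
  rw [((isZero_zero _).of_iso (asIso (0 : Z ⟶ 0))).eq_of_src h 0, comp_zero]

end GhostLemma

section ProjDim

variable {C : Type*} [Category C] [Abelian C]

lemma HasProjDimLE.hasProjectiveDimensionLE {M : C} {n : ℕ} (h : HasProjDimLE M n) :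
    HasProjectiveDimensionLE M n := by
  obtain ⟨P, hP⟩ := h
  let := HasExt.standard C
  rw [HasProjectiveDimensionLE, hasProjectiveDimensionLT_iff]
  intro i hi Y e
  obtain ⟨f, hf, rfl⟩ := P.extMk_surjective e (i + 1) rfl
  obtain rfl : f = 0 := (hP i (by lia)).eq_of_src _ _
  simp

/-- Splicing a short exact sequence with projective middle term and a projective resolution of its
first term. -/
lemma CategoryTheory.ShortComplex.ShortExact.exists_projectiveResolution
    {S : ShortComplex C} (hS : S.ShortExact) (h₂ : Projective S.X₂)
    (P : ProjectiveResolution S.X₁) :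
    ∃ Q : ProjectiveResolution S.X₃, ∀ i, Q.complex.X (i + 1) = P.complex.X i := by
  obtain ⟨ε, hε, hε', hε''⟩ : ∃ (ε : P.complex.X 0 ⟶ S.X₁) (w : P.complex.d 1 0 ≫ ε = 0),
      (ShortComplex.mk _ _ w).Exact ∧ Epi ε :=
    ⟨P.π.f 0, P.complex_d_comp_π_f_zero, P.exact₀, inferInstanceAs (Epi (P.π.f 0))⟩
  have := hS.mono_f
  have := hS.epi_g
  let K := P.complex.augment (ε ≫ S.f) (by rw [← Category.assoc, hε, zero_comp])
  have hw : K.d 1 0 ≫ S.g = 0 := by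
    change (ε ≫ S.f) ≫ S.g = 0
    simp
  have h₀ : (ShortComplex.mk _ _ hw).Exact := by
    let φ : ShortComplex.mk (ε ≫ S.f) S.g (by simp) ⟶ S := { τ₁ := ε, τ₂ := 𝟙 _, τ₃ := 𝟙 _ }
    exact (ShortComplex.exact_iff_of_epi_of_isIso_of_mono φ).2 hS.exact
  have h₁ : K.ExactAt 1 := by
    rw [HomologicalComplex.exactAt_iff' _ 2 1 0 (by simp) (by simp)]
    let φ : ShortComplex.mk _ _ hε ⟶ ShortComplex.mk (P.complex.d 1 0) (ε ≫ S.f)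
      (by rw [← Category.assoc, hε, zero_comp]) := { τ₁ := 𝟙 _, τ₂ := 𝟙 _, τ₃ := S.f }
    have : Epi φ.τ₁ := inferInstanceAs (Epi (𝟙 _))
    exact (ShortComplex.exact_iff_of_epi_of_isIso_of_mono φ).1 hε'
  have h (n : ℕ) : K.ExactAt (n + 2) := by
    rw [HomologicalComplex.exactAt_iff' _ (n + 3) (n + 2) (n + 1) (by simp) (by simp)]
    exact P.exact_succ n
  let π := (ChainComplex.toSingle₀Equiv K S.X₃).symm ⟨S.g, hw⟩
  have hπ : π.f 0 = S.g :=
    ChainComplex.toSingle₀Equiv_symm_apply_f_zero (C := K) (X := S.X₃) S.g hw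
  refine ⟨{
    complex := K
    projective := fun i ↦ by
      cases i
      · exact h₂
      · exact P.projective _
    π := π
    quasiIso := ⟨fun n ↦ ?_⟩ }, fun i ↦ rfl⟩
  obtain _ | _ | n := n
  · rw [ChainComplex.quasiIsoAt₀_iff, ShortComplex.quasiIso_iff_of_zeros']
    · refine (ShortComplex.exact_and_epi_g_iff_of_iso ?_).2 ⟨h₀, this⟩
      exact ShortComplex.isoMk (Iso.refl _) (Iso.refl _) (Iso.refl _)
        ((Category.id_comp _).trans (Category.comp_id _).symm)
        ((Category.id_comp _).trans (hπ.symm.trans (Category.comp_id (π.f 0)).symm))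
    all_goals rfl
  · rw [quasiIsoAt_iff_exactAt']
    · exact h₁
    · apply ChainComplex.exactAt_succ_single_obj
  · rw [quasiIsoAt_iff_exactAt']
    · exact h n
    · apply ChainComplex.exactAt_succ_single_obj

lemma CategoryTheory.HasProjectiveDimensionLE.hasProjDimLE [EnoughProjectives C] {M : C} {n : ℕ}
    (h : HasProjectiveDimensionLE M n) : HasProjDimLE M n := by
  induction n generalizing M with
  | zero =>
    have : Projective M := (projective_iff_hasProjectiveDimensionLE_zero _).2 h
    exact ⟨.self M, fun i hi ↦ HomologicalComplex.isZero_single_obj_X _ _ _ _ (by lia)⟩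
  | succ n ih =>
    let S := ShortComplex.mk _ _ (kernel.condition (Projective.π M))
    have hS : S.ShortExact :=
      { exact := ShortComplex.exact_of_f_is_kernel _ (kernelIsKernel S.g) }
    have : Projective S.X₂ := Projective.projective_over M
    obtain ⟨P, hP⟩ := ih ((hS.hasProjectiveDimensionLT_X₃_iff n this).1 h)
    obtain ⟨Q, hQ⟩ := hS.exists_projectiveResolution this P
    refine ⟨Q, fun i hi ↦ ?_⟩
    obtain _ | i := i
    · lia
    · exact hQ i ▸ hP i (by lia)

end ProjDim

section ExtGhost

universe w'

variable {C : Type*} [Category C] [Abelian C] [HasDerivedCategory.{w} C]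

lemma isZero_homologyFunctor_obj_singleFunctor_obj (X : C) {i j : ℤ} (hij : i ≠ j) :
    IsZero ((homologyFunctor C i).obj ((singleFunctor C j).obj X)) := by
  obtain h | h := lt_or_gt_of_ne hij
  · exact isZero_of_isGE _ j i h
  · exact isZero_of_isLE _ j i h

lemma isZero_homologyFunctor_obj_singleFunctor_obj_shift (X : C) {a i : ℤ} (h : a + i ≠ 0) :
    IsZero ((homologyFunctor C i).obj (((singleFunctor C 0).obj X)⟦a⟧)) :=
  (isZero_homologyFunctor_obj_singleFunctor_obj X h).of_iso
    (((homologyFunctor C 0).shiftIso a i (a + i) rfl).app _)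

lemma isGhost_of_singleFunctor_shift {X Y : C} {a b : ℤ} (hab : a ≠ b)
    (f : ((singleFunctor C 0).obj X)⟦a⟧ ⟶ ((singleFunctor C 0).obj Y)⟦b⟧) : IsGhost f := by
  intro i
  by_cases h : a + i = 0
  · exact (isZero_homologyFunctor_obj_singleFunctor_obj_shift Y (by lia)).eq_of_tgt _ _
  · exact (isZero_homologyFunctor_obj_singleFunctor_obj_shift X h).eq_of_src _ _

lemma isGhost_of_singleFunctor {X Y : C} {b : ℤ} (hb : b ≠ 0)
    (f : (singleFunctor C 0).obj X ⟶ ((singleFunctor C 0).obj Y)⟦b⟧) : IsGhost f := by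
  intro i
  by_cases h : i = 0
  · exact (isZero_homologyFunctor_obj_singleFunctor_obj_shift Y (by lia)).eq_of_tgt _ _
  · exact (isZero_homologyFunctor_obj_singleFunctor_obj X h).eq_of_src _ _

/-- If there are enough injectives, any extension class of positive degree `n + 1` is
a composite of `n + 1` ghosts. -/
lemma CategoryTheory.Abelian.Ext.isGhostComposite_hom [HasExt.{w'} C] [EnoughInjectives C]
    {X Y : C} {n : ℕ} (e : Ext.{w'} X Y (n + 1)) : IsGhostComposite e.hom (n + 1) := by
  induction n generalizing Y with
  | zero => exact .single (isGhost_of_singleFunctor (by simp) _)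
  | succ n ih =>
    let S := ShortComplex.mk _ _ (cokernel.condition (Injective.ι Y))
    have hS : S.ShortExact :=
      { exact := ShortComplex.exact_of_g_is_cokernel _ (cokernelIsCokernel S.f) }
    have : Injective S.X₂ := Injective.injective_under Y
    obtain ⟨e', rfl⟩ := Ext.covariant_sequence_exact₁ X hS e (Ext.eq_zero_of_injective _) rfl
    rw [Ext.comp_hom]
    exact (ih e').comp (isGhost_of_singleFunctor_shift (a := (n + 1 : ℕ)) (by simp) _)

lemma hasProjectiveDimensionLE_of_ghost_composites_eq_zero [EnoughInjectives C] {n : ℕ}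
    (h : ∀ (X Y : DerivedCategory C) (f : X ⟶ Y), IsGhostComposite f (n + 1) → f = 0) (M : C) :
    HasProjectiveDimensionLE M n := by
  let := HasExt.standard C
  refine hasProjectiveDimensionLT_of_enoughInjectives M (n + 1) fun Y ↦
    subsingleton_of_forall_eq 0 fun e ↦ Ext.ext ?_
  rw [h _ _ _ e.isGhostComposite_hom, Ext.zero_hom]

end ExtGhost

section Universe

universe u v v'

variable {A : Type u} [Ring A]

open ModuleCat

lemma Module.Baer.of_subsingleton_ext (N : ModuleCat.{max u v} A)
    (h : ∀ I : Ideal A, Subsingleton (Ext (ModuleCat.of A (ULift.{v} (A ⧸ I))) N 1)) :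
    Module.Baer A N := by
  intro I g
  let f : ULift.{v} I →ₗ[A] ULift.{v} A :=
    ULift.moduleEquiv.symm.toLinearMap ∘ₗ I.subtype ∘ₗ ULift.moduleEquiv.toLinearMap
  let q : ULift.{v} A →ₗ[A] ULift.{v} (A ⧸ I) :=
    ULift.moduleEquiv.symm.toLinearMap ∘ₗ I.mkQ ∘ₗ ULift.moduleEquiv.toLinearMap
  have hfq : Function.Exact f q := by
    intro x
    simp only [f, q, LinearMap.coe_comp, LinearEquiv.coe_coe, Function.comp_apply,
      LinearEquiv.map_eq_zero_iff, Submodule.mkQ_apply, Submodule.Quotient.mk_eq_zero]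
    exact ⟨fun hx ↦ ⟨⟨⟨_, hx⟩⟩, rfl⟩, by rintro ⟨y, rfl⟩; exact y.down.2⟩
  let S : ShortComplex (ModuleCat.{max u v} A) :=
    ModuleCat.shortComplexOfCompEqZero f q hfq.linearMap_comp_eq_zero
  have hS : S.ShortExact := ModuleCat.shortComplex_shortExact S hfq
    (ULift.moduleEquiv.symm.injective.comp
      (I.injective_subtype.comp ULift.moduleEquiv.injective))
    (ULift.moduleEquiv.symm.surjective.comp
      (I.mkQ_surjective.comp ULift.moduleEquiv.surjective))
  obtain ⟨g', hg'⟩ := Ext.contravariant_sequence_exact₁ hS N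
    (Ext.mk₀ (ModuleCat.ofHom (g ∘ₗ ULift.moduleEquiv.toLinearMap))) (add_zero 1)
    ((h I).elim _ _)
  obtain ⟨g', rfl⟩ := (Ext.mk₀_bijective _ _).surjective g'
  rw [Ext.mk₀_comp_mk₀] at hg'
  replace hg' := (Ext.mk₀_bijective _ _).injective hg'
  refine ⟨g'.hom ∘ₗ ULift.moduleEquiv.symm.toLinearMap, fun x hx ↦ ?_⟩
  exact ConcreteCategory.congr_hom hg' (ULift.up ⟨x, hx⟩)

/-- Injective dimension is detected by the vanishing of `Ext` out of cyclic modules. -/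
lemma ModuleCat.hasInjectiveDimensionLE_of_subsingleton_ext (N : ModuleCat.{max u v} A) (n : ℕ)
    (h : ∀ I : Ideal A, Subsingleton (Ext (ModuleCat.of A (ULift.{v} (A ⧸ I))) N (n + 1))) :
    HasInjectiveDimensionLE N n := by
  induction n generalizing N with
  | zero =>
    have := (Module.Baer.of_subsingleton_ext N h).injective
    have : Injective N := Module.injective_object_of_injective_module A N
    exact inferInstanceAs (HasInjectiveDimensionLT N 1)
  | succ n ih =>
    let S := ShortComplex.mk _ _ (cokernel.condition (Injective.ι N))
    have hS : S.ShortExact :=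
      { exact := ShortComplex.exact_of_g_is_cokernel _ (cokernelIsCokernel S.f) }
    have : Injective S.X₂ := Injective.injective_under N
    refine (hS.hasInjectiveDimensionLT_X₃_iff _ this).1 (ih _ fun I ↦ ?_)
    refine subsingleton_of_forall_eq 0 fun e ↦ ?_
    obtain ⟨e', rfl⟩ := Ext.covariant_sequence_exact₃ _ hS e rfl ((h I).elim _ _)
    rw [Ext.eq_zero_of_injective e', Ext.zero_comp]

/-- **Auslander's theorem**: the global dimension is determined by the cyclic modules. -/
lemma ModuleCat.hasProjectiveDimensionLE_of_cyclic (n : ℕ)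
    (h : ∀ I : Ideal A, HasProjectiveDimensionLE (ModuleCat.of A (ULift.{v} (A ⧸ I))) n)
    (M : ModuleCat.{max u v} A) : HasProjectiveDimensionLE M n := by
  have hN (N : ModuleCat.{max u v} A) : HasInjectiveDimensionLE N n :=
    hasInjectiveDimensionLE_of_subsingleton_ext N n fun I ↦
      have := h I
      HasProjectiveDimensionLT.subsingleton _ (n + 1) _ le_rfl _
  rw [HasProjectiveDimensionLE, hasProjectiveDimensionLT_iff]
  intro i hi N e
  have := hN N
  exact e.eq_zero_of_hasInjectiveDimensionLT (n + 1) hi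

/-- Bounds on the global dimension do not depend on the universe of the modules. -/
lemma ModuleCat.forall_hasProjectiveDimensionLE_of_forall {n : ℕ}
    (h : ∀ M : ModuleCat.{max u v'} A, HasProjectiveDimensionLE M n) (M : ModuleCat.{max u v} A) :
    HasProjectiveDimensionLE M n :=
  hasProjectiveDimensionLE_of_cyclic n (fun I ↦
    have := h (ModuleCat.of A (ULift.{v'} (A ⧸ I)))
    hasProjectiveDimensionLE_of_linearEquiv.{max u v', max u v}
      (M := ModuleCat.of A (ULift.{v'} (A ⧸ I)))
      (ULift.moduleEquiv.trans ULift.moduleEquiv.symm) n) M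

end Universe

/-- The right global dimension of `R` is at most `n` (every right `R`-module has
projective dimension at most `n`) if and only if every composite of `n + 1` ghosts in the
derived category of right `R`-modules is zero. -/
theorem rightGlobalDim_le_iff_ghost_composites_vanish
    (R : Type) [Ring R] [HasDerivedCategory.{w} (ModuleCat Rᵐᵒᵖ)] (n : ℕ) :
    (∀ M : ModuleCat Rᵐᵒᵖ, HasProjDimLE M n) ↔
      ∀ (X Y : DerivedCategory (ModuleCat Rᵐᵒᵖ)) (f : X ⟶ Y),
        IsGhostComposite f (n + 1) → f = 0 := by
  refine ⟨fun h X Y f hf ↦ hf.eq_zero fun i ↦ ?_, fun h M ↦ ?_⟩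
  · exact ModuleCat.forall_hasProjectiveDimensionLE_of_forall
      (fun M ↦ (h M).hasProjectiveDimensionLE) _
  · exact (ModuleCat.forall_hasProjectiveDimensionLE_of_forall
      (hasProjectiveDimensionLE_of_ghost_composites_eq_zero h) M).hasProjDimLE
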